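/- For all real $\nu$ with $3/8 \le \nu \le 5/8$, all $\beta$ with $1/2 \le \beta \le 1$, and all real $x$, one has $\cosh((2\nu-1)x) \le (1-\beta) + \beta\cosh(x/2)$. -/

import Mathlib

theorem stmt_3 (ν β x : ℝ) (hν1 : 3/8 ≤ ν) (hν2 : ν ≤ 5/8)
    (hβ1 : 1/2 ≤ β) (hβ2 : β ≤ 1) :
    Real.cosh ((2*ν - 1) * x) ≤ (1 - β) + β * Real.cosh (x / 2) := by
  have hmono : Real.cosh ((2*ν - 1) * x) ≤ Real.cosh (x / 4) := by
    have hν : |2*ν - 1| ≤ 1/4 := abs_le.2 ⟨by linarith, by linarith⟩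
    rw [Real.cosh_le_cosh, abs_mul, abs_div, abs_of_pos (by norm_num : (0:ℝ) < 4)]
    nlinarith [mul_le_mul_of_nonneg_right hν (abs_nonneg x)]
  have hdouble : Real.cosh (x / 2) = 2 * Real.cosh (x / 4) ^ 2 - 1 := by
    rw [show x / 2 = 2 * (x / 4) by ring, Real.cosh_two_mul, Real.sinh_sq]
    ring
  have hone : 1 ≤ Real.cosh (x / 4) := Real.one_le_cosh _
  have hsq : 0 ≤ Real.cosh (x / 4) ^ 2 - 1 := by nlinarith
  rw [hdouble]
  nlinarith [mul_nonneg (sub_nonneg.2 hβ1) hsq]
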